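/- arXiv:2601.12163 — 2 statements merged into one kernel-verified Lean document; each statement's English description precedes it below -/
import Mathlib

section
/- Let P be a polynomial of degree d ≥ 2 with coefficients in K, and let O ⊆ K be a cycle of P with multiplier λ = ∏_{z∈O} P'(z). If |λ| < λ(d)^{#O}, then P has a critical point attracted to O: there exist c ∈ K with P'(c) = 0 and a point z ∈ O such that the sequence (P^{n·#O}(c))_{n≥1} converges to z in K. (This is Theorem A of the paper in the case of a polynomial map and a cycle contained in K; for polynomials this case is equivalent to the full statement, since the only critical point of P at infinity is fixed.) -/
/-!
STATEMENT 0 (Theorem A, polynomial case): Let `K` be an algebraically closed field,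
complete with respect to a nontrivial non-archimedean absolute value (formalized as a
nontrivially normed field with ultrametric distance that is complete and algebraically
closed).  For an integer `d ≥ 2`, `lam K d := min {‖m‖ : 1 ≤ m ≤ d}`.  If `P` is a
polynomial of degree `d ≥ 2`, `O = {z0, P z0, …, P^{N-1} z0}` is a cycle of `P` of exact
period `N` with multiplier `λ = ∏_{i<N} P'(P^i z0)` satisfying `‖λ‖ < lam K d ^ N`, then
`P` has a critical point `c` attracted to the cycle: `P'(c) = 0` and `(P^{nN} c)_n`
converges to some point `P^i z0` of the cycle.
-/

open Polynomial Filter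

/-- `lam K d = min {‖(m : K)‖ : m ∈ {1, …, d}}`. -/
noncomputable def lam (K : Type*) [NormedField K] (d : ℕ) : ℝ :=
  ⨅ m : Finset.Icc 1 d, ‖((m : ℕ) : K)‖

section helpers

/-- Gauss norm of a polynomial at radius `r`. -/
noncomputable def gN {K : Type*} [NormedField K] (q : Polynomial K) (r : ℝ) : ℝ :=
  (Finset.range (q.natDegree + 1)).sup' ⟨0, by simp⟩ (fun m => ‖q.coeff m‖ * r ^ m)

/-- radii along the orbit -/
def rad (ψ : ℕ → ℝ → ℝ) : ℕ → ℝ → ℝ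
  | 0, r => r
  | (i + 1), r => rad ψ i r * ψ i (rad ψ i r)

theorem rad_eq (ψ : ℕ → ℝ → ℝ) (n : ℕ) (r : ℝ) :
    rad ψ n r = r * ∏ i ∈ Finset.range n, ψ i (rad ψ i r) := by
  induction n with
  | zero => simp [rad]
  | succ n ih => rw [Finset.prod_range_succ, ← mul_assoc, ← ih, rad]

theorem rad_cont (ψ : ℕ → ℝ → ℝ) (hc : ∀ i, Continuous (ψ i)) (n : ℕ) :
    Continuous (rad ψ n) := by
  induction n with
  | zero => exact continuous_id
  | succ n ih => exact ih.mul ((hc n).comp ih)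

theorem rad_zero (ψ : ℕ → ℝ → ℝ) (n : ℕ) : rad ψ n 0 = 0 := by
  rw [rad_eq]; simp

theorem rad_nonneg (ψ : ℕ → ℝ → ℝ) (h0 : ∀ i r, 0 ≤ r → 0 ≤ ψ i r) (n : ℕ) (r : ℝ)
    (hr : 0 ≤ r) : 0 ≤ rad ψ n r := by
  induction n with
  | zero => exact hr
  | succ n ih => exact mul_nonneg ih (h0 _ _ ih)

theorem rad_pos (ψ : ℕ → ℝ → ℝ) (h0 : ∀ i r, 0 < r → 0 < ψ i r) (n : ℕ) (r : ℝ)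
    (hr : 0 < r) : 0 < rad ψ n r := by
  induction n with
  | zero => exact hr
  | succ n ih => exact mul_pos ih (h0 _ _ ih)

theorem rad_mono (ψ : ℕ → ℝ → ℝ) (h0 : ∀ i r, 0 ≤ r → 0 ≤ ψ i r)
    (hm : ∀ i r s, 0 ≤ r → r ≤ s → ψ i r ≤ ψ i s) (n : ℕ) (r s : ℝ)
    (hr : 0 ≤ r) (hrs : r ≤ s) : rad ψ n r ≤ rad ψ n s := by
  induction n with
  | zero => exact hrs
  | succ n ih =>
    have h1 := rad_nonneg ψ h0 n r hr
    exact mul_le_mul ih (hm _ _ _ h1 ih) (h0 _ _ h1) (h1.trans ih)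

theorem rad_top (ψ : ℕ → ℝ → ℝ) (ht : ∀ i, Tendsto (ψ i) atTop atTop) (n : ℕ) :
    Tendsto (rad ψ n) atTop atTop := by
  induction n with
  | zero => exact tendsto_id
  | succ n ih => exact ih.atTop_mul_atTop₀ ((ht n).comp ih)

theorem rad_main (ψ : ℕ → ℝ → ℝ) (N : ℕ) (hc : ∀ i, Continuous (ψ i))
    (h0 : ∀ i r, 0 ≤ r → 0 ≤ ψ i r)
    (hm : ∀ i r s, 0 ≤ r → r ≤ s → ψ i r ≤ ψ i s)
    (ht : ∀ i, Tendsto (ψ i) atTop atTop)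
    (hl : ∏ i ∈ Finset.range N, ψ i 0 < 1) :
    ∃ r0, 0 < r0 ∧ rad ψ N r0 = r0 ∧ ∀ r, 0 ≤ r → r < r0 →
      Tendsto (fun n => (rad ψ N)^[n] r) atTop (nhds 0) := by
  set Φ := rad ψ N with hΦ
  have hΦc : Continuous Φ := rad_cont ψ hc N
  have hg : Continuous fun r => ∏ i ∈ Finset.range N, ψ i (rad ψ i r) :=
    continuous_finsetProd _ fun i _ => (hc i).comp (rad_cont ψ hc i)
  have hsmall : ∃ ε > 0, ∀ r, 0 < r → r < ε → Φ r < r := by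
    have h1 : ∀ᶠ r in nhds (0:ℝ), ∏ i ∈ Finset.range N, ψ i (rad ψ i r) < 1 := by
      apply hg.continuousAt.eventually_lt continuousAt_const
      simpa [rad_zero] using hl
    obtain ⟨ε, hε, h⟩ := Metric.eventually_nhds_iff.1 h1
    refine ⟨ε, hε, fun r hr hre => ?_⟩
    have h2 := @h r (by simpa [abs_of_pos hr] using hre)
    rw [hΦ, rad_eq]
    nlinarith
  obtain ⟨ε, hε, hsm⟩ := hsmall
  have hlarge : ∃ r, 0 < r ∧ r ≤ Φ r := by
    have h1 : ∀ᶠ r in atTop, ∀ i ∈ Finset.range N, 1 ≤ ψ i (rad ψ i r) := by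
      rw [Filter.eventually_all_finset]
      intro i _
      exact ((ht i).comp (rad_top ψ ht i)).eventually_ge_atTop 1
    obtain ⟨r, h, hr⟩ := (h1.and (eventually_gt_atTop 0)).exists
    refine ⟨r, hr, ?_⟩
    have h2 : 1 ≤ ∏ i ∈ Finset.range N, ψ i (rad ψ i r) := by
      have := Finset.prod_le_prod (s := Finset.range N) (f := fun _ => (1:ℝ))
        (g := fun i => ψ i (rad ψ i r)) (fun _ _ => zero_le_one) h
      simpa using this
    rw [hΦ, rad_eq]
    nlinarith
  let S : Set ℝ := {r | ε ≤ r ∧ r ≤ Φ r}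
  have hSne : S.Nonempty := by
    obtain ⟨r, hr, h⟩ := hlarge
    refine ⟨r, ?_, h⟩
    by_contra hh
    exact absurd (hsm r hr (not_le.1 hh)) (not_lt.2 h)
  have hScl : IsClosed S :=
    (isClosed_le continuous_const continuous_id).inter (isClosed_le continuous_id hΦc)
  have hSb : BddBelow S := ⟨ε, fun r hr => hr.1⟩
  have hmem : sInf S ∈ S := hScl.csInf_mem hSne hSb
  set r0 := sInf S
  have hr0 : 0 < r0 := hε.trans_le hmem.1
  have hlt : ∀ r, 0 < r → r < r0 → Φ r < r := by
    intro r hr hrr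
    by_contra hh
    rw [not_lt] at hh
    have : ε ≤ r := by
      by_contra h3
      exact absurd (hsm r hr (not_le.1 h3)) (not_lt.2 hh)
    exact absurd (csInf_le hSb (show r ∈ S from ⟨this, hh⟩)) (not_le.2 hrr)
  refine ⟨r0, hr0, le_antisymm ?_ hmem.2, ?_⟩
  · have h1 : Tendsto Φ (nhdsWithin r0 (Set.Iio r0)) (nhds (Φ r0)) :=
      hΦc.continuousAt.tendsto.mono_left nhdsWithin_le_nhds
    refine le_of_tendsto h1 ?_
    filter_upwards [Ioo_mem_nhdsLT hr0] with r hr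
    exact (hlt r hr.1 hr.2).le.trans hr.2.le
  · intro r hr hrr
    have hle : ∀ r, 0 ≤ r → r < r0 → Φ r ≤ r := by
      intro r hr hrr
      rcases hr.eq_or_lt with h | h
      · rw [← h, hΦ, rad_zero]
      · exact (hlt r h hrr).le
    have hin : ∀ n, 0 ≤ Φ^[n] r ∧ Φ^[n] r < r0 := by
      intro n
      induction n with
      | zero => exact ⟨hr, hrr⟩
      | succ n ih =>
        rw [Function.iterate_succ_apply']
        exact ⟨rad_nonneg ψ h0 N _ ih.1, (hle _ ih.1 ih.2).trans_lt ih.2⟩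
    have hanti : Antitone fun n => Φ^[n] r := by
      apply antitone_nat_of_succ_le
      intro n
      rw [Function.iterate_succ_apply']
      exact hle _ (hin n).1 (hin n).2
    have hbb : BddBelow (Set.range fun n => Φ^[n] r) := by
      refine ⟨0, ?_⟩
      rintro _ ⟨n, rfl⟩
      exact (hin n).1
    have hlim := tendsto_atTop_ciInf hanti hbb
    set L := ⨅ n, Φ^[n] r
    have hL0 : 0 ≤ L := ge_of_tendsto' hlim fun n => (hin n).1
    have hLr : L < r0 := (ciInf_le hbb 0).trans_lt hrr
    have hfix : Φ L = L := isFixedPt_of_tendsto_iterate hlim hΦc.continuousAt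
    rcases hL0.eq_or_lt with h | h
    · rwa [← h] at hlim
    · exact absurd (hlt L h hLr) (by rw [hfix]; exact lt_irrefl _)

variable {K : Type*}

theorem gN_cont [NormedField K] (q : Polynomial K) : Continuous (gN q) := by
  unfold gN
  exact Continuous.finset_sup'_apply _ fun i _ => by fun_prop

theorem le_gN [NormedField K] (q : Polynomial K) (r : ℝ) (m : ℕ) (hm : m ≤ q.natDegree) :
    ‖q.coeff m‖ * r ^ m ≤ gN q r := by
  unfold gN
  exact Finset.le_sup' (fun m => ‖q.coeff m‖ * r ^ m) (Finset.mem_range.2 (by omega))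

theorem gN_att [NormedField K] (q : Polynomial K) (r : ℝ) :
    ∃ m, m ≤ q.natDegree ∧ gN q r = ‖q.coeff m‖ * r ^ m := by
  unfold gN
  obtain ⟨m, h, e⟩ := Finset.exists_mem_eq_sup' (s := Finset.range (q.natDegree + 1))
    ⟨0, by simp⟩ (fun m => ‖q.coeff m‖ * r ^ m)
  exact ⟨m, by simpa [Nat.lt_succ_iff] using h, e⟩

theorem gN_nonneg [NormedField K] (q : Polynomial K) (r : ℝ) (hr : 0 ≤ r) : 0 ≤ gN q r := by
  obtain ⟨m, _, e⟩ := gN_att q r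
  rw [e]; positivity

theorem gN_mono [NormedField K] (q : Polynomial K) (r s : ℝ) (hr : 0 ≤ r) (h : r ≤ s) :
    gN q r ≤ gN q s := by
  obtain ⟨m, hm, e⟩ := gN_att q r
  rw [e]
  refine le_trans ?_ (le_gN q s m hm)
  gcongr

theorem gN_zero [NormedField K] (q : Polynomial K) : gN q 0 = ‖q.coeff 0‖ := by
  apply le_antisymm
  · obtain ⟨m, hm, e⟩ := gN_att q 0
    rw [e]
    rcases Nat.eq_zero_or_pos m with h | h
    · subst h; simp
    · rw [zero_pow h.ne']; simp
  · simpa using le_gN q 0 0 (Nat.zero_le _)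

theorem gN_top [NormedField K] (q : Polynomial K) (hq : 0 < q.natDegree) :
    Tendsto (gN q) atTop atTop := by
  have h0 : 0 < ‖q.coeff q.natDegree‖ := by
    rw [norm_pos_iff, coeff_natDegree, Ne, leadingCoeff_eq_zero]
    rintro rfl
    simp at hq
  refine tendsto_atTop_mono (fun r => le_gN q r q.natDegree le_rfl) ?_
  exact (tendsto_pow_atTop hq.ne').const_mul_atTop h0

theorem gN_pos [NormedField K] (q : Polynomial K) (hq : q ≠ 0) (r : ℝ) (hr : 0 < r) :
    0 < gN q r := by
  refine lt_of_lt_of_le ?_ (le_gN q r q.natDegree le_rfl)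
  have : 0 < ‖q.coeff q.natDegree‖ := by
    rw [norm_pos_iff, coeff_natDegree, Ne, leadingCoeff_eq_zero]
    exact hq
  positivity

theorem eval_le_gN [NormedField K] [IsUltrametricDist K] (q : Polynomial K) (x : K) :
    ‖q.eval x‖ ≤ gN q ‖x‖ := by
  rw [eval_eq_sum_range]
  refine IsUltrametricDist.norm_sum_le_of_forall_le_of_nonneg (gN_nonneg _ _ (norm_nonneg _)) ?_
  intro i hi
  rw [norm_mul, norm_pow]
  exact le_gN q _ i (by simpa [Nat.lt_succ_iff] using hi)

theorem no_root_coeff [NormedField K] [IsAlgClosed K] [IsUltrametricDist K] (Q : Polynomial K)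
    (r : ℝ) (hr : 0 < r) (h : ∀ x, ‖x‖ < r → Q.eval x ≠ 0) (m : ℕ) :
    ‖Q.coeff m‖ * r ^ m ≤ ‖Q.coeff 0‖ := by
  have key : ∀ s : Multiset K, (∀ a ∈ s, r ≤ ‖a‖) → ∀ m,
      ‖(s.map fun a => X - C a).prod.coeff m‖ * r ^ m ≤
        ‖(s.map fun a => X - C a).prod.coeff 0‖ := by
    intro s
    induction s using Multiset.induction with
    | empty =>
      intro _ m
      rcases Nat.eq_zero_or_pos m with h | h
      · subst h; simp
      · simp [coeff_one, h.ne']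
    | cons a s ih =>
      intro hs m
      have ih := ih fun b hb => hs b (Multiset.mem_cons_of_mem hb)
      have ha := hs a (Multiset.mem_cons_self a s)
      rw [Multiset.map_cons, Multiset.prod_cons]
      set T := (s.map fun a => X - C a).prod
      have e0 : ((X - C a) * T).coeff 0 = - (a * T.coeff 0) := by
        simp [sub_mul]
      cases m with
      | zero => simp
      | succ m =>
        have e1 : ((X - C a) * T).coeff (m + 1) = T.coeff m - a * T.coeff (m + 1) := by
          simp [sub_mul]
        rw [e0, e1, norm_neg, norm_mul]
        have h1 : ‖T.coeff m - a * T.coeff (m + 1)‖ ≤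
            max ‖T.coeff m‖ ‖a * T.coeff (m + 1)‖ := by
          rw [sub_eq_add_neg, ← norm_neg (a * T.coeff (m + 1))]
          exact IsUltrametricDist.norm_add_le_max _ _
        refine (mul_le_mul_of_nonneg_right h1 (by positivity)).trans ?_
        rw [max_mul_of_nonneg _ _ (by positivity)]
        apply max_le
        · calc ‖T.coeff m‖ * r ^ (m + 1) = r * (‖T.coeff m‖ * r ^ m) := by ring
            _ ≤ ‖a‖ * ‖T.coeff 0‖ := mul_le_mul ha (ih m) (by positivity) (by positivity)
        · rw [norm_mul, mul_assoc]
          exact mul_le_mul_of_nonneg_left (ih (m + 1)) (norm_nonneg _)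
  have hsp := (IsAlgClosed.splits Q).eq_prod_roots
  have hQ : Q ≠ 0 := by
    rintro rfl
    exact h 0 (by simpa using hr) (by simp)
  have hk := key Q.roots (fun a ha => by
    by_contra hh
    exact h a (not_le.1 hh) ((mem_roots hQ).1 ha)) m
  rw [hsp, coeff_C_mul, coeff_C_mul, norm_mul, norm_mul, mul_assoc]
  exact mul_le_mul_of_nonneg_left hk (norm_nonneg _)

end helpers

theorem critical_point_attracted_to_attracting_cycle
    {K : Type*} [NontriviallyNormedField K] [IsAlgClosed K]
    [CompleteSpace K] [IsUltrametricDist K]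
    (P : Polynomial K) (d : ℕ) (hd : 2 ≤ d) (hdeg : P.natDegree = d)
    (z0 : K) (N : ℕ) (hN : 0 < N)
    (hper : (fun z => P.eval z)^[N] z0 = z0)
    (hmin : ∀ m : ℕ, 0 < m → m < N → (fun z => P.eval z)^[m] z0 ≠ z0)
    (hlt : ‖∏ i ∈ Finset.range N, P.derivative.eval ((fun z => P.eval z)^[i] z0)‖ <
      lam K d ^ N) :
    ∃ c : K, P.derivative.eval c = 0 ∧ ∃ i < N,
      Tendsto (fun n => (fun z => P.eval z)^[n * N] c) atTop
        (nhds ((fun z => P.eval z)^[i] z0)) := by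
  set f : K → K := fun z => P.eval z with hf
  let z : ℕ → K := fun i => f^[i] z0
  have hzs : ∀ i, z (i + 1) = P.eval (z i) := fun i => Function.iterate_succ_apply' f i z0
  have hzN : z N = z0 := hper
  let q : ℕ → Polynomial K := fun i => (taylor (z i) P).divX
  have hqdeg : ∀ i, (q i).natDegree = d - 1 := by
    intro i
    simp only [q, natDegree_divX_eq_natDegree_tsub_one, natDegree_taylor, hdeg]
  have hqc : ∀ i m, (q i).coeff m = (taylor (z i) P).coeff (m + 1) := fun i m => coeff_divX
  have hq0 : ∀ i, (q i).coeff 0 = P.derivative.eval (z i) := by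
    intro i
    rw [hqc, zero_add, taylor_coeff_one]
  have hfac : ∀ i x, P.eval x - z (i + 1) = (x - z i) * (q i).eval (x - z i) := by
    intro i x
    have h1 := congrArg (eval (x - z i)) (divX_mul_X_add (taylor (z i) P))
    rw [taylor_eval, eval_add, eval_mul, eval_X, eval_C, taylor_coeff_zero] at h1
    rw [hzs]
    rw [sub_add_cancel] at h1
    rw [← h1]; ring
  let ψ : ℕ → ℝ → ℝ := fun i => gN (q i)
  have hqne : ∀ i, q i ≠ 0 := by
    intro i h
    have := hqdeg i
    rw [h, natDegree_zero] at this
    omega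
  have hlam0 : 0 ≤ lam K d := Real.iInf_nonneg fun _ => norm_nonneg _
  have hlam : ∀ m, 1 ≤ m → m ≤ d → lam K d ≤ ‖(m : K)‖ := by
    intro m h1 h2
    exact ciInf_le (f := fun m : Finset.Icc 1 d => ‖((m : ℕ) : K)‖)
      ⟨0, by rintro _ ⟨x, rfl⟩; exact norm_nonneg _⟩ ⟨m, Finset.mem_Icc.2 ⟨h1, h2⟩⟩
  have hlam1 : lam K d ≤ 1 := by simpa using hlam 1 le_rfl (by omega)
  have hψc : ∀ i, Continuous (ψ i) := fun i => gN_cont _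
  have hψ0 : ∀ i r, 0 ≤ r → 0 ≤ ψ i r := fun i r hr => gN_nonneg _ _ hr
  have hψm : ∀ i r s, 0 ≤ r → r ≤ s → ψ i r ≤ ψ i s := fun i r s h1 h2 => gN_mono _ _ _ h1 h2
  have hψp : ∀ i r, 0 < r → 0 < ψ i r := fun i r hr => gN_pos _ (hqne i) _ hr
  have hψt : ∀ i, Tendsto (ψ i) atTop atTop :=
    fun i => gN_top _ (by rw [hqdeg]; omega)
  rw [norm_prod] at hlt
  obtain ⟨r0, hr0, hfix, hconv⟩ := rad_main ψ N hψc hψ0 hψm hψt (by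
    have : ∏ i ∈ Finset.range N, ψ i 0 =
        ∏ i ∈ Finset.range N, ‖P.derivative.eval (f^[i] z0)‖ := by
      refine Finset.prod_congr rfl fun i _ => ?_
      simp only [ψ]
      rw [gN_zero, hq0]
    rw [this]
    exact hlt.trans_le (pow_le_one₀ hlam0 hlam1))
  have hcrit : ∃ i < N, ∃ c, ‖c - z i‖ < rad ψ i r0 ∧ P.derivative.eval c = 0 := by
    by_contra hno
    push Not at hno
    have hb : ∀ i ∈ Finset.range N, lam K d * ψ i (rad ψ i r0) ≤
        ‖P.derivative.eval (f^[i] z0)‖ := by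
      intro i hi
      have hi := Finset.mem_range.1 hi
      have hri := rad_pos ψ hψp i r0 hr0
      obtain ⟨m, hm, e⟩ := gN_att (q i) (rad ψ i r0)
      rw [hqdeg] at hm
      have h1 := no_root_coeff (taylor (z i) P.derivative) (rad ψ i r0) hri (by
        intro x hx
        rw [taylor_eval]
        exact hno i hi _ (by simpa using hx)) m
      have h2 : (taylor (z i) P.derivative).coeff m = (q i).coeff m * ((m + 1 : ℕ) : K) := by
        have h3 : taylor (z i) P.derivative = derivative (taylor (z i) P) := by
          simp [taylor_apply, derivative_comp]
        rw [h3, coeff_derivative, hqc]; push_cast; ring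
      rw [taylor_coeff_zero, h2, norm_mul] at h1
      change lam K d * gN (q i) (rad ψ i r0) ≤ _
      rw [e]
      refine le_trans ?_ h1
      have h4 := hlam (m + 1) (by omega) (by omega)
      calc lam K d * (‖(q i).coeff m‖ * rad ψ i r0 ^ m)
          ≤ ‖((m + 1 : ℕ) : K)‖ * (‖(q i).coeff m‖ * rad ψ i r0 ^ m) :=
            mul_le_mul_of_nonneg_right h4 (by positivity)
        _ = _ := by ring
    have h5 := Finset.prod_le_prod (fun i _ =>
      mul_nonneg hlam0 (hψp i _ (rad_pos ψ hψp i r0 hr0)).le) hb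
    rw [Finset.prod_mul_distrib, Finset.prod_const, Finset.card_range] at h5
    have h6 := rad_eq ψ N r0
    rw [hfix] at h6
    have h7 : ∏ i ∈ Finset.range N, ψ i (rad ψ i r0) = 1 :=
      mul_left_cancel₀ hr0.ne' (by rw [← h6, mul_one])
    rw [h7, mul_one] at h5
    exact absurd hlt (not_lt.2 h5)
  have hest : ∀ i x, ‖P.eval x - z (i + 1)‖ ≤ ‖x - z i‖ * ψ i ‖x - z i‖ := by
    intro i x
    rw [hfac, norm_mul]
    exact mul_le_mul_of_nonneg_left (eval_le_gN _ _) (norm_nonneg _)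
  have hit : ∀ k x, ‖f^[k] x - z k‖ ≤ rad ψ k ‖x - z0‖ := by
    intro k x
    induction k with
    | zero => exact le_rfl
    | succ k ih =>
      rw [Function.iterate_succ_apply']
      refine (hest k _).trans ?_
      exact mul_le_mul ih (hψm _ _ _ (norm_nonneg _) ih) (hψ0 _ _ (norm_nonneg _))
        ((norm_nonneg _).trans ih)
  have hit2 : ∀ n x, ‖(f^[N])^[n] x - z0‖ ≤ (rad ψ N)^[n] ‖x - z0‖ := by
    intro n x
    induction n with
    | zero => exact le_rfl
    | succ n ih =>
      rw [Function.iterate_succ_apply', Function.iterate_succ_apply']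
      have := hit N ((f^[N])^[n] x)
      rw [hzN] at this
      exact this.trans (rad_mono ψ hψ0 hψm N _ _ (norm_nonneg _) ih)
  have hbas : ∀ x, ‖x - z0‖ < r0 → Tendsto (fun n => (f^[N])^[n] x) atTop (nhds z0) := by
    intro x hx
    rw [tendsto_iff_norm_sub_tendsto_zero]
    exact squeeze_zero (fun _ => norm_nonneg _) (fun n => hit2 n x)
      (hconv _ (norm_nonneg _) hx)
  obtain ⟨i, hi, c, hc, hc0⟩ := hcrit
  refine ⟨c, hc0, i, hi, ?_⟩
  have hforw : ∀ k, ‖f^[k] c - z (i + k)‖ < rad ψ (i + k) r0 := by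
    intro k
    induction k with
    | zero => exact hc
    | succ k ih =>
      rw [Function.iterate_succ_apply']
      refine (hest (i + k) _).trans_lt ?_
      exact mul_lt_mul_of_lt_of_le_of_nonneg_of_pos ih
        (hψm _ _ _ (norm_nonneg _) ih.le) (norm_nonneg _)
        (hψp _ _ (rad_pos ψ hψp _ r0 hr0))
  have hw : ‖f^[N - i] c - z0‖ < r0 := by
    have := hforw (N - i)
    rwa [Nat.add_sub_cancel' hi.le, hfix, hzN] at this
  have hfc : Continuous f := P.continuous
  have hlim := ((hfc.iterate i).tendsto z0).comp (hbas _ hw)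
  rw [← tendsto_add_atTop_iff_nat 1]
  refine hlim.congr fun n => ?_
  simp only [Function.comp]
  rw [← Function.iterate_mul, ← Function.iterate_add_apply, ← Function.iterate_add_apply]
  congr 2
  rw [Nat.add_mul, one_mul, Nat.mul_comm]
  omega
end

section
/- Let P be a polynomial of degree d ≥ 2 with coefficients in K. Then the set of cycles O ⊆ K of P satisfying ∏_{z∈O} |P'(z)| < λ(d)^{#O} is finite, and its cardinality is at most the cardinality of the set {c ∈ K : P'(c) = 0}. (This is Corollary 1.2 of the paper in the polynomial case, for cycles contained in K.) -/
open Polynomial Filter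

/-- `O` is a cycle of the polynomial `P`: `O = {z0, P z0, …, P^{N-1} z0}` with
`N = #O ≥ 1`, `P^N z0 = z0` and `P^m z0 ≠ z0` for `0 < m < N`. -/
def IsCycle {K : Type*} [Field K] (P : Polynomial K) (O : Finset K) : Prop :=
  O.Nonempty ∧ ∃ z0 : K,
    (fun z => P.eval z)^[O.card] z0 = z0 ∧
    (∀ m : ℕ, 0 < m → m < O.card → (fun z => P.eval z)^[m] z0 ≠ z0) ∧
    (∀ z : K, z ∈ O ↔ ∃ i < O.card, z = (fun z => P.eval z)^[i] z0)

noncomputable def psiF {K : Type*} [NormedField K] (P : Polynomial K) (z : K) (r : ℝ) : ℝ :=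
  (Finset.range (P.natDegree + 1)).sup' ⟨0, by simp⟩
    (fun k => ‖(taylor z P).coeff (k+1)‖ * r ^ k)

noncomputable def PhiF {K : Type*} [NormedField K] (P : Polynomial K) (z : K) : ℕ → ℝ → ℝ
  | 0, r => r
  | n+1, r => PhiF P z n r * psiF P ((fun x => P.eval x)^[n] z) (PhiF P z n r)

section
variable {K : Type*} [NormedField K] (P : Polynomial K)

lemma psiF_cont (z : K) : Continuous (psiF P z) := by
  unfold psiF
  apply Continuous.finset_sup'_apply
  intro i _
  fun_prop

lemma psiF_nonneg (z : K) {r : ℝ} (hr : 0 ≤ r) : 0 ≤ psiF P z r := by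
  unfold psiF
  refine le_trans ?_ (Finset.le_sup' _ (b := 0) (by simp))
  positivity

lemma psiF_mono (z : K) {r s : ℝ} (hr : 0 ≤ r) (hrs : r ≤ s) : psiF P z r ≤ psiF P z s := by
  unfold psiF
  apply Finset.sup'_le
  intro k hk
  refine le_trans ?_ (Finset.le_sup' _ hk)
  gcongr

lemma psiF_zero (z : K) : psiF P z 0 = ‖P.derivative.eval z‖ := by
  unfold psiF
  apply le_antisymm
  · apply Finset.sup'_le
    intro k hk
    rcases k with _ | k
    · simp [taylor_coeff_one]
    · simp
  · refine le_trans ?_ (Finset.le_sup' _ (b := 0) (by simp))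
    simp [taylor_coeff_one]

lemma PhiF_nonneg (z : K) (n : ℕ) {r : ℝ} (hr : 0 ≤ r) : 0 ≤ PhiF P z n r := by
  induction n with
  | zero => exact hr
  | succ n ih => exact mul_nonneg ih (psiF_nonneg P _ ih)

lemma PhiF_cont (z : K) (n : ℕ) : Continuous (PhiF P z n) := by
  induction n with
  | zero => exact continuous_id
  | succ n ih => exact ih.mul ((psiF_cont P _).comp ih)

lemma PhiF_mono (z : K) (n : ℕ) {r s : ℝ} (hr : 0 ≤ r) (hrs : r ≤ s) :
    PhiF P z n r ≤ PhiF P z n s := by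
  induction n with
  | zero => exact hrs
  | succ n ih =>
    exact mul_le_mul ih (psiF_mono P _ (PhiF_nonneg P z n hr) ih)
      (psiF_nonneg P _ (PhiF_nonneg P z n hr)) (PhiF_nonneg P z n (hr.trans hrs))

lemma PhiF_zero (z : K) (n : ℕ) : PhiF P z n 0 = 0 := by
  induction n with
  | zero => rfl
  | succ n ih => simp [PhiF, ih]

lemma PhiF_add (z : K) (N n : ℕ) (hN : (fun x => P.eval x)^[N] z = z) (r : ℝ) :
    PhiF P z (N + n) r = PhiF P z n (PhiF P z N r) := by
  induction n with
  | zero => rfl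
  | succ n ih =>
    have : (fun x => P.eval x)^[N+n] z = (fun x => P.eval x)^[n] z := by
      rw [add_comm, Function.iterate_add_apply, hN]
    rw [← add_assoc]
    simp only [PhiF]
    rw [ih, this]

lemma PhiF_eq (z : K) (N : ℕ) (r : ℝ) :
    PhiF P z N r =
      r * ∏ i ∈ Finset.range N, psiF P ((fun x => P.eval x)^[i] z) (PhiF P z i r) := by
  induction N with
  | zero => simp [PhiF]
  | succ n ih => rw [Finset.prod_range_succ, ← mul_assoc, ← ih]; rfl

lemma psiF_large (z : K) (hd : 2 ≤ P.natDegree) {r : ℝ} (h1 : 1 ≤ r)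
    (h2 : ‖P.leadingCoeff‖⁻¹ ≤ r) : 1 ≤ psiF P z r := by
  have hlc : 0 < ‖P.leadingCoeff‖ := by
    rw [norm_pos_iff, leadingCoeff_ne_zero]
    rintro rfl
    simp at hd
  unfold psiF
  refine le_trans ?_ (Finset.le_sup' _ (b := P.natDegree - 1) (by simp))
  have e : P.natDegree - 1 + 1 = P.natDegree := by omega
  have : (taylor z P).coeff P.natDegree = P.leadingCoeff := by
    rw [← leadingCoeff_taylor z P, leadingCoeff, natDegree_taylor]
  rw [e, this]
  calc 1 = ‖P.leadingCoeff‖ * ‖P.leadingCoeff‖⁻¹ := by field_simp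
    _ ≤ ‖P.leadingCoeff‖ * r := by gcongr
    _ ≤ _ := by
      gcongr
      exact le_self_pow₀ h1 (by omega)

lemma PhiF_large (z : K) (hd : 2 ≤ P.natDegree) {r : ℝ} (h1 : 1 ≤ r)
    (h2 : ‖P.leadingCoeff‖⁻¹ ≤ r) (n : ℕ) : r ≤ PhiF P z n r := by
  induction n with
  | zero => exact le_rfl
  | succ n ih =>
    have := psiF_large P ((fun x => P.eval x)^[n] z) hd (h1.trans ih) (h2.trans ih)
    exact ih.trans (le_mul_of_one_le_right (by linarith) this)

lemma eval_dist_le [IsUltrametricDist K] (z x : K) :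
    ‖P.eval x - P.eval z‖ ≤ ‖x - z‖ * psiF P z ‖x - z‖ := by
  have h : P.eval x - P.eval z =
      ∑ k ∈ Finset.range (P.natDegree), (taylor z P).coeff (k+1) * (x - z)^(k+1) := by
    have h1 : P.eval x = (taylor z P).eval (x - z) := by simp [taylor_eval]
    rw [h1, eval_eq_sum_range, natDegree_taylor, Finset.sum_range_succ', taylor_coeff_zero]
    simp
  rw [h]
  apply IsUltrametricDist.norm_sum_le_of_forall_le_of_nonneg
  · exact mul_nonneg (norm_nonneg _) (psiF_nonneg P _ (norm_nonneg _))
  · intro k hk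
    rw [norm_mul, norm_pow, pow_succ', mul_left_comm]
    gcongr
    unfold psiF
    exact Finset.le_sup' (fun k => ‖(taylor z P).coeff (k+1)‖ * ‖x - z‖ ^ k)
      (by simp at hk ⊢; omega)

lemma orbit_le [IsUltrametricDist K] (z c : K) (i : ℕ) {r : ℝ} (hr : 0 ≤ r)
    (h : ‖c - (fun x => P.eval x)^[i] z‖ ≤ PhiF P z i r) (n : ℕ) :
    ‖(fun x => P.eval x)^[n] c - (fun x => P.eval x)^[i + n] z‖ ≤ PhiF P z (i + n) r := by
  induction n with
  | zero => exact h
  | succ n ih =>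
    rw [← add_assoc, Function.iterate_succ_apply', Function.iterate_succ_apply']
    refine (eval_dist_le P _ _).trans ?_
    exact mul_le_mul ih (psiF_mono P _ (norm_nonneg _) ih)
      (psiF_nonneg P _ (norm_nonneg _)) (PhiF_nonneg P z _ hr)

lemma coeff_prod_le [IsUltrametricDist K] {r : ℝ} (hr : 0 ≤ r) (s : Multiset K)
    (hs : ∀ a ∈ s, r ≤ ‖a‖) (k : ℕ) :
    ‖((s.map fun a => X - C a).prod).coeff k‖ * r ^ k ≤
      ‖((s.map fun a => X - C a).prod).coeff 0‖ := by
  induction s using Multiset.induction_on generalizing k with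
  | empty =>
    rcases k with _ | k
    · simp
    · simp [coeff_one]
  | cons a s ih =>
    have ih := ih (fun b hb => hs b (Multiset.mem_cons_of_mem hb))
    have ha := hs a (Multiset.mem_cons_self a s)
    simp only [Multiset.map_cons, Multiset.prod_cons]
    set q := (s.map fun a => X - C a).prod
    rcases k with _ | k
    · simp
    · have e : ((X - C a) * q).coeff (k+1) = q.coeff k - a * q.coeff (k+1) := by
        simp [sub_mul]
      have e0 : ‖((X - C a) * q).coeff 0‖ = ‖a‖ * ‖q.coeff 0‖ := by
        simp [mul_coeff_zero]
      rw [e, e0]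
      have h1 := ih k
      have h2 := ih (k+1)
      have hm : ‖q.coeff k - a * q.coeff (k+1)‖ ≤ max ‖q.coeff k‖ ‖a * q.coeff (k+1)‖ := by
        simpa [sub_eq_add_neg] using
          IsUltrametricDist.norm_add_le_max (q.coeff k) (-(a * q.coeff (k+1)))
      have hp : 0 ≤ r^(k+1) := by positivity
      refine (mul_le_mul_of_nonneg_right hm hp).trans ?_
      rcases max_cases ‖q.coeff k‖ ‖a * q.coeff (k+1)‖ with ⟨h, _⟩ | ⟨h, _⟩
      · rw [h, pow_succ, ← mul_assoc, mul_comm]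
        exact mul_le_mul ha h1 (by positivity) (norm_nonneg _)
      · rw [h, norm_mul, mul_assoc]
        gcongr

lemma coeff_le_of_no_root [IsUltrametricDist K] [IsAlgClosed K] (Q : Polynomial K) (z : K) {r : ℝ}
    (hr : 0 ≤ r) (h : ∀ c, Q.eval c = 0 → r ≤ ‖c - z‖) (k : ℕ) :
    ‖(taylor z Q).coeff k‖ * r ^ k ≤ ‖(taylor z Q).coeff 0‖ := by
  by_cases hQ : Q = 0
  · simp [hQ]
  set T := taylor z Q with hT
  have hs : T = C T.leadingCoeff * (T.roots.map fun a => X - C a).prod :=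
    (IsAlgClosed.splits T).eq_prod_roots
  have := coeff_prod_le hr T.roots (by
    intro a ha
    have h1 : T.eval a = 0 := isRoot_of_mem_roots ha
    rw [hT, taylor_eval] at h1
    simpa using h _ h1) k
  rw [hs, coeff_C_mul, coeff_C_mul, norm_mul, norm_mul, mul_assoc]
  gcongr

lemma lam_le (d k : ℕ) (h1 : 1 ≤ k) (h2 : k ≤ d) : lam K d ≤ ‖(k : K)‖ := by
  unfold lam
  exact ciInf_le (Set.finite_range _).bddBelow (⟨k, by simp [h1, h2]⟩ : Finset.Icc 1 d)

lemma lam_nonneg (d : ℕ) : 0 ≤ lam K d := Real.iInf_nonneg fun _ => norm_nonneg _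

lemma taylor_deriv_coeff (z : K) (k : ℕ) :
    (taylor z P.derivative).coeff k = (taylor z P).coeff (k+1) * (k + 1) := by
  have : taylor z P.derivative = (taylor z P).derivative := by
    simp [taylor_apply, derivative_comp]
  rw [this, coeff_derivative]

lemma lam_psi_le [IsUltrametricDist K] [IsAlgClosed K] (z : K) {r : ℝ}
    (hr : 0 ≤ r) (h : ∀ c, P.derivative.eval c = 0 → r ≤ ‖c - z‖) :
    lam K P.natDegree * psiF P z r ≤ ‖P.derivative.eval z‖ := by
  unfold psiF
  obtain ⟨k, hk, e⟩ := Finset.exists_mem_eq_sup' (s := Finset.range (P.natDegree + 1))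
    ⟨0, by simp⟩ (fun k => ‖(taylor z P).coeff (k+1)‖ * r ^ k)
  rw [e]
  by_cases hkd : k < P.natDegree
  · have h1 := coeff_le_of_no_root P.derivative z hr h k
    rw [taylor_coeff_zero, taylor_deriv_coeff, norm_mul] at h1
    have h2 := lam_le (K := K) P.natDegree (k+1) (by omega) hkd
    push_cast at h2
    refine le_trans ?_ h1
    calc _ ≤ ‖(k:K)+1‖ * (‖(taylor z P).coeff (k+1)‖ * r ^ k) := by gcongr
      _ = _ := by ring
  · rw [coeff_eq_zero_of_natDegree_lt (by rw [natDegree_taylor]; omega)]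
    simp

lemma exists_crit [IsUltrametricDist K] [IsAlgClosed K] (hd : 2 ≤ P.natDegree) (z : K) (N : ℕ)
    (hN : (fun x => P.eval x)^[N] z = z)
    (hlt : ∏ i ∈ Finset.range N, ‖P.derivative.eval ((fun x => P.eval x)^[i] z)‖
      < lam K P.natDegree ^ N) :
    ∃ c, P.derivative.eval c = 0 ∧ ∃ i < N,
      Tendsto (fun k => (fun x => P.eval x)^[N * k] c) atTop
        (nhds ((fun x => P.eval x)^[i] z)) := by
  set f := (fun x => P.eval x) with hf
  set M : ℝ → ℝ := fun r => ∏ i ∈ Finset.range N, psiF P (f^[i] z) (PhiF P z i r) with hM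
  have hMc : Continuous M :=
    continuous_finsetProd _ fun i _ => (psiF_cont P _).comp (PhiF_cont P z i)
  have hMm : ∀ r s, 0 ≤ r → r ≤ s → M r ≤ M s := fun r s hr hrs =>
    Finset.prod_le_prod (fun i _ => psiF_nonneg P _ (PhiF_nonneg P z i hr))
      fun i _ => psiF_mono P _ (PhiF_nonneg P z i hr) (PhiF_mono P z i hr hrs)
  have hMn : ∀ r, 0 ≤ r → 0 ≤ M r := fun r hr =>
    Finset.prod_nonneg fun i _ => psiF_nonneg P _ (PhiF_nonneg P z i hr)
  have hlam1 : lam K P.natDegree ≤ 1 := by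
    simpa using lam_le (K := K) P.natDegree 1 le_rfl (by omega)
  have hM0 : M 0 < 1 := by
    simp only [hM, PhiF_zero, psiF_zero]
    exact hlt.trans_le (pow_le_one₀ (lam_nonneg _) hlam1)
  set S : Set ℝ := {r | 0 ≤ r ∧ 1 ≤ M r} with hS
  have hSc : IsClosed S :=
    (isClosed_le continuous_const continuous_id).inter (isClosed_le continuous_const hMc)
  have hSb : BddBelow S := ⟨0, fun r hr => hr.1⟩
  have hSn : S.Nonempty := by
    refine ⟨max 1 ‖P.leadingCoeff‖⁻¹, by positivity, ?_⟩
    have hh := fun n => PhiF_large P z hd (le_max_left 1 ‖P.leadingCoeff‖⁻¹)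
      (le_max_right 1 ‖P.leadingCoeff‖⁻¹) n
    simp only [hM]
    exact Finset.one_le_prod fun i _ =>
      psiF_large P _ hd ((le_max_left _ _).trans (hh i)) ((le_max_right _ _).trans (hh i))
  set R := sInf S
  have hR : R ∈ S := hSc.csInf_mem hSn hSb
  have hRpos : 0 < R := by
    rcases hR.1.lt_or_eq with h | h
    · exact h
    · exact absurd hR.2 (by rw [← h]; exact not_le.mpr hM0)
  have hlt1 : ∀ r, 0 ≤ r → r < R → M r < 1 := fun r hr h => by
    by_contra hc
    exact absurd (csInf_le hSb (show r ∈ S from ⟨hr, not_lt.mp hc⟩)) (not_le.mpr h)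
  -- find critical point
  have key : ∃ c, P.derivative.eval c = 0 ∧ ∃ i < N, ‖c - f^[i] z‖ < PhiF P z i R := by
    by_contra! hcon
    have : lam K P.natDegree ^ N * M R ≤
        ∏ i ∈ Finset.range N, ‖P.derivative.eval (f^[i] z)‖ := by
      calc _ = ∏ i ∈ Finset.range N,
            (lam K P.natDegree * psiF P (f^[i] z) (PhiF P z i R)) := by
            rw [Finset.prod_mul_distrib]; simp [hM]
        _ ≤ _ := Finset.prod_le_prod
            (fun i _ => mul_nonneg (lam_nonneg _) (psiF_nonneg P _ (PhiF_nonneg P z i hR.1)))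
            fun i hi => lam_psi_le P _ (PhiF_nonneg P z i hR.1)
              fun c hc => hcon c hc i (Finset.mem_range.mp hi)
    have h2 : lam K P.natDegree ^ N ≤ lam K P.natDegree ^ N * M R :=
      le_mul_of_one_le_right (pow_nonneg (lam_nonneg _) _) hR.2
    linarith
  obtain ⟨c, hc, i, hi, hci⟩ := key
  refine ⟨c, hc, i, hi, ?_⟩
  obtain ⟨r, hr0, hrR, hcr⟩ : ∃ r, 0 ≤ r ∧ r < R ∧ ‖c - f^[i] z‖ ≤ PhiF P z i r := by
    have h1 : ∀ᶠ r in nhdsWithin R (Set.Iio R), ‖c - f^[i] z‖ < PhiF P z i r :=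
      ((PhiF_cont P z i).tendsto R).eventually (lt_mem_nhds hci) |>.filter_mono nhdsWithin_le_nhds
    have h2 : ∀ᶠ r in nhdsWithin R (Set.Iio R), r ∈ Set.Ioo 0 R := Ioo_mem_nhdsLT hRpos
    obtain ⟨r, ha, hb⟩ := (h1.and h2).exists
    exact ⟨r, hb.1.le, hb.2, ha.le⟩
  have hNk : ∀ k, f^[N * k] z = z := fun k => by
    rw [Function.iterate_mul]; exact Function.iterate_fixed hN k
  have hdec : ∀ k, PhiF P z (N * k) r ≤ r * M r ^ k := by
    intro k
    induction k with
    | zero => simp [PhiF]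
    | succ k ih =>
      have h0 := PhiF_nonneg P z (N * k) hr0
      have hler : PhiF P z (N * k) r ≤ r := ih.trans
        (mul_le_of_le_one_right hr0 (pow_le_one₀ (hMn r hr0) (hlt1 r hr0 hrR).le))
      rw [mul_add, mul_one, PhiF_add P z (N * k) N (hNk k), PhiF_eq, pow_succ, ← mul_assoc]
      exact mul_le_mul ih (hMm _ _ h0 hler) (hMn _ h0)
        (mul_nonneg hr0 (pow_nonneg (hMn r hr0) _))
  have ht : Tendsto (fun k => PhiF P z (N * k) r) atTop (nhds 0) := by
    refine squeeze_zero (fun k => PhiF_nonneg P z _ hr0) hdec ?_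
    simpa using (tendsto_pow_atTop_nhds_zero_of_lt_one (hMn r hr0) (hlt1 r hr0 hrR)).const_mul r
  have ht2 : Tendsto (fun k => PhiF P z i (PhiF P z (N * k) r)) atTop (nhds 0) := by
    have := ((PhiF_cont P z i).tendsto 0).comp ht
    rwa [PhiF_zero] at this
  rw [tendsto_iff_norm_sub_tendsto_zero]
  refine squeeze_zero (fun _ => norm_nonneg _) (fun k => ?_) ht2
  have := orbit_le P z c i hr0 hcr (N * k)
  rw [Function.iterate_add_apply, ← hf, hNk k] at this
  rwa [add_comm, PhiF_add P z (N * k) i (hNk k)] at this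

lemma IsCycle.exists_crit [IsUltrametricDist K] [IsAlgClosed K] (hd : 2 ≤ P.natDegree)
    {O : Finset K} (hO : IsCycle P O)
    (hlt : ∏ z ∈ O, ‖P.derivative.eval z‖ < lam K P.natDegree ^ O.card) :
    ∃ c, P.derivative.eval c = 0 ∧ ∃ w ∈ O,
      Tendsto (fun k => (fun x => P.eval x)^[O.card * k] c) atTop (nhds w) := by
  classical
  obtain ⟨hne, z, hz, -, hmem⟩ := hO
  have hOi : O = (Finset.range O.card).image (fun i => (fun x => P.eval x)^[i] z) := by
    ext w
    rw [hmem w]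
    simp [eq_comm]
  have hinj : Set.InjOn (fun i => (fun x => P.eval x)^[i] z) (Finset.range O.card) := by
    rw [← Finset.card_image_iff, ← hOi, Finset.card_range]
  have hprod : ∏ z ∈ O, ‖P.derivative.eval z‖ =
      ∏ i ∈ Finset.range O.card, ‖P.derivative.eval ((fun x => P.eval x)^[i] z)‖ := by
    conv_lhs => rw [hOi]
    rw [Finset.prod_image hinj]
  rw [hprod] at hlt
  obtain ⟨c, hc, i, hi, ht⟩ := _root_.exists_crit P hd z O.card hz hlt
  exact ⟨c, hc, _, (hmem _).2 ⟨i, hi, rfl⟩, ht⟩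

lemma IsCycle.subset {P : Polynomial K} {O O' : Finset K} (hO : IsCycle P O) (hO' : IsCycle P O') {w : K}
    (hw : w ∈ O) (hw' : w ∈ O') : O ⊆ O' := by
  obtain ⟨hne, z, hz, -, hmem⟩ := hO
  obtain ⟨hne', z', hz', -, hmem'⟩ := hO'
  have hall' : ∀ n, (fun x => P.eval x)^[n] z' ∈ O' := by
    intro n
    rw [hmem']
    refine ⟨n % O'.card, Nat.mod_lt _ hne'.card_pos, ?_⟩
    exact (Function.IsPeriodicPt.iterate_mod_apply hz' n).symm
  obtain ⟨i, hi, rfl⟩ := (hmem w).1 hw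
  obtain ⟨j, hj, hij⟩ := (hmem' _).1 hw'
  intro x hx
  obtain ⟨l, hl, rfl⟩ := (hmem x).1 hx
  have : (fun x => P.eval x)^[l] z = (fun x => P.eval x)^[l + (O.card - i) + j] z' := by
    rw [Function.iterate_add_apply _ _ j, ← hij, ← Function.iterate_add_apply,
      show l + (O.card - i) + i = l + O.card by omega, Function.iterate_add_apply, hz]
  rw [this]
  exact hall' _

end

theorem finitely_many_cycles_of_small_multiplier
    {K : Type*} [NontriviallyNormedField K] [IsAlgClosed K]
    [CompleteSpace K] [IsUltrametricDist K]
    (P : Polynomial K) (d : ℕ) (hd : 2 ≤ d) (hdeg : P.natDegree = d) :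
    {O : Finset K | IsCycle P O ∧
        ∏ z ∈ O, ‖P.derivative.eval z‖ < lam K d ^ O.card}.Finite ∧
    {O : Finset K | IsCycle P O ∧
        ∏ z ∈ O, ‖P.derivative.eval z‖ < lam K d ^ O.card}.ncard ≤
      {c : K | P.derivative.eval c = 0}.ncard := by
  classical
  subst hdeg
  have hex : ∀ O ∈ {O : Finset K | IsCycle P O ∧
        ∏ z ∈ O, ‖P.derivative.eval z‖ < lam K P.natDegree ^ O.card},
      ∃ c, P.derivative.eval c = 0 ∧ ∃ w ∈ O,
      Tendsto (fun k => (fun x => P.eval x)^[O.card * k] c) atTop (nhds w) :=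
    fun O hO => IsCycle.exists_crit P hd hO.1 hO.2
  by_cases hP : P.derivative = 0
  · have hempty : {O : Finset K | IsCycle P O ∧
        ∏ z ∈ O, ‖P.derivative.eval z‖ < lam K P.natDegree ^ O.card} = ∅ := by
      rw [Set.eq_empty_iff_forall_notMem]
      rintro O ⟨hO, hlt⟩
      have hd0 : (P.natDegree : K) = 0 := by
        have h1 := congrArg (fun Q => Q.coeff (P.natDegree - 1)) hP
        simp only [coeff_derivative, coeff_zero] at h1
        rw [show P.natDegree - 1 + 1 = P.natDegree by omega] at h1
        rcases mul_eq_zero.1 h1 with h | h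
        · exfalso
          have : P = 0 := leadingCoeff_eq_zero.1 h
          simp [this] at hd
        · rw [← h, ← Nat.cast_add_one, show P.natDegree - 1 + 1 = P.natDegree by omega]
      have hl : lam K P.natDegree = 0 := le_antisymm
        (by simpa [hd0] using lam_le (K := K) P.natDegree P.natDegree (by omega) le_rfl)
        (lam_nonneg _)
      rw [hl, zero_pow hO.1.card_pos.ne'] at hlt
      exact absurd hlt (not_lt.mpr (Finset.prod_nonneg fun _ _ => norm_nonneg _))
    rw [hempty]
    simp
  have hfin : {c : K | P.derivative.eval c = 0}.Finite := by
    refine (P.derivative.roots.toFinset.finite_toSet).subset fun c hc => ?_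
    simpa [hP] using hc
  choose! g hg w hw ht using hex
  have hinj : Set.InjOn g {O : Finset K | IsCycle P O ∧
        ∏ z ∈ O, ‖P.derivative.eval z‖ < lam K P.natDegree ^ O.card} := by
    intro O hO O' hO' he
    have hc := hO.1.1.card_pos
    have hc' := hO'.1.1.card_pos
    have t1 := (ht O hO).comp (tendsto_id.const_mul_atTop' hc')
    have t2 := (ht O' hO').comp (tendsto_id.const_mul_atTop' hc)
    have hww : w O = w O' := by
      refine tendsto_nhds_unique t1 (t2.congr fun k => ?_)
      simp only [Function.comp, id]
      rw [he, mul_left_comm]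
    have h' := hw O' hO'
    rw [← hww] at h'
    exact Finset.Subset.antisymm (hO.1.subset hO'.1 (hw O hO) h')
      (hO'.1.subset hO.1 h' (hw O hO))
  exact ⟨Set.Finite.of_injOn (t := {c : K | P.derivative.eval c = 0}) (fun O hO => hg O hO) hinj hfin, Set.ncard_le_ncard_of_injOn g hg hinj hfin⟩
end
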